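/- arXiv:1709.05985 — 2 statements merged into one kernel-verified Lean document; each statement's English description precedes it below -/
import Mathlib

section
/- Let k be an infinite field and let d ≥ 5. For general forms f₁, f₂, f₃ of degree d in R = k[x,y], setting I = (f₁, f₂, f₃) (a codimension 2 ideal), the Rees algebra R[It] = ⊕_{ℓ≥0} I^ℓ t^ℓ has depth exactly 1 with respect to its graded maximal ideal 𝓜 = (x, y, ⊕_{ℓ≥1} I^ℓ t^ℓ). -/
open MvPolynomial

set_option synthInstance.maxHeartbeats 1000000

noncomputable section

/-- The binary form of degree `d` in `k[x,y]` with coefficient vector `c`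
(`x := X 0`, `y := X 1`). -/
def formOf {k : Type*} [Field k] (d : ℕ) (c : Fin (d + 1) → k) :
    MvPolynomial (Fin 2) k :=
  ∑ l : Fin (d + 1), C (c l) * X 0 ^ (l : ℕ) * X 1 ^ (d - (l : ℕ))

/-- The graded maximal ideal `𝓜 = (x, y, ⊕_{ℓ≥1} I^ℓ t^ℓ)` of the Rees algebra
`R[It] ⊆ R[t]` of an ideal `I ⊆ k[x,y]`: the preimage of `(x,y)` under the map
sending an element of the Rees algebra to its constant (in `t`) coefficient. -/
def reesMax {k : Type*} [Field k] (I : Ideal (MvPolynomial (Fin 2) k)) :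
    Ideal (reesAlgebra I) :=
  Ideal.comap
    ((Polynomial.evalRingHom (0 : MvPolynomial (Fin 2) k)).comp
      (reesAlgebra I).val.toRingHom)
    (Ideal.span {X 0, X 1})

/-- The set of lengths of `𝓜`-regular sequences on the Rees algebra `R[It]`;
the depth of `R[It]` with respect to `𝓜` is its supremum. -/
def reesDepthSet {k : Type*} [Field k] (I : Ideal (MvPolynomial (Fin 2) k)) : Set ℕ :=
  {n | ∃ rs : List (reesAlgebra I), rs.length = n ∧ (∀ r ∈ rs, r ∈ reesMax I) ∧
    RingTheory.Sequence.IsRegular (reesAlgebra I) rs}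

section Depth

variable {k : Type*} [Field k]

theorem mem_reesMax_iff {I : Ideal (MvPolynomial (Fin 2) k)} {r : reesAlgebra I} :
    r ∈ reesMax I ↔ (r : Polynomial (MvPolynomial (Fin 2) k)).coeff 0 ∈
      Ideal.span {(X 0 : MvPolynomial (Fin 2) k), X 1} := by
  simp [reesMax, Ideal.mem_comap, Polynomial.coeff_zero_eq_eval_zero]

theorem one_notMem_span_X :
    (1 : MvPolynomial (Fin 2) k) ∉ Ideal.span {(X 0 : MvPolynomial (Fin 2) k), X 1} := by
  rw [Ideal.mem_span_pair]
  rintro ⟨a, b, h⟩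
  simpa using congrArg (eval 0) h

theorem reesMax_ne_top (I : Ideal (MvPolynomial (Fin 2) k)) : reesMax I ≠ ⊤ := by
  rw [Ideal.ne_top_iff_one, mem_reesMax_iff]
  simpa using one_notMem_span_X

theorem one_mem_reesDepthSet (I : Ideal (MvPolynomial (Fin 2) k)) : 1 ∈ reesDepthSet I := by
  set r : reesAlgebra I := algebraMap (MvPolynomial (Fin 2) k) (reesAlgebra I) (X 0)
  have hr : (r : Polynomial (MvPolynomial (Fin 2) k)) = Polynomial.C (X 0) := rfl
  have hmem : r ∈ reesMax I := by
    rw [mem_reesMax_iff, hr, Polynomial.coeff_C_zero]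
    exact Ideal.subset_span (by simp)
  have hne : r ≠ 0 := fun h ↦ by
    have := congrArg (Subtype.val) h
    simp [hr] at this
  refine ⟨[r], rfl, by simpa using hmem, ?_, ?_⟩
  · rw [RingTheory.Sequence.isWeaklyRegular_singleton_iff]
    exact (isSMulRegular_iff_right_eq_zero_of_smul (M := reesAlgebra I)).2 fun m hm ↦
      (mul_eq_zero.1 hm).resolve_left hne
  · intro h
    refine reesMax_ne_top I (top_le_iff.1 (h.le.trans ?_))
    rw [Ideal.ofList_singleton, smul_eq_mul, Ideal.mul_top, Ideal.span_singleton_le_iff_mem]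
    exact hmem

/-- An element of `R[t]` outside the Rees algebra which is multiplied into it by the
graded maximal ideal forces the depth to be at most one. -/
theorem le_one_of_mem_reesDepthSet {I : Ideal (MvPolynomial (Fin 2) k)}
    {z : Polynomial (MvPolynomial (Fin 2) k)} (hz : z ∉ reesAlgebra I)
    (hmul : ∀ r ∈ reesMax I, (r : Polynomial (MvPolynomial (Fin 2) k)) * z ∈ reesAlgebra I)
    {n : ℕ} (hn : n ∈ reesDepthSet I) : n ≤ 1 := by
  obtain ⟨rs, rfl, hrs, hreg⟩ := hn
  match rs, hrs, hreg with
  | [], _, _ => simp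
  | [_], _, _ => simp
  | a :: b :: rs, hrs, hreg =>
    exfalso
    have hw := hreg.toIsWeaklyRegular
    rw [RingTheory.Sequence.isWeaklyRegular_cons_iff,
      RingTheory.Sequence.isWeaklyRegular_cons_iff] at hw
    obtain ⟨ha, hb, -⟩ := hw
    have ha0 : (a : Polynomial (MvPolynomial (Fin 2) k)) ≠ 0 := fun h ↦ by
      have h0 : a = 0 := Subtype.ext h
      have h1 : (1 : reesAlgebra I) = 0 := ha (by simp [h0])
      exact one_ne_zero h1
    let u : reesAlgebra I := ⟨a * z, hmul a (hrs a (by simp))⟩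
    let v : reesAlgebra I := ⟨b * z, hmul b (hrs b (by simp))⟩
    have huv : b * u = a * v := Subtype.ext (by simp only [u, v, MulMemClass.coe_mul]; ring)
    have hu : (Submodule.Quotient.mk u : QuotSMulTop a (reesAlgebra I)) = 0 := by
      apply hb
      simp only [smul_zero]
      rw [← Submodule.Quotient.mk_smul, Submodule.Quotient.mk_eq_zero, smul_eq_mul, huv]
      exact Submodule.smul_mem_pointwise_smul v a ⊤ trivial
    rw [Submodule.Quotient.mk_eq_zero, Submodule.mem_smul_pointwise_iff_exists] at hu
    obtain ⟨w, -, hw⟩ := hu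
    have : (w : Polynomial (MvPolynomial (Fin 2) k)) = z :=
      mul_left_cancel₀ ha0 (congrArg Subtype.val hw)
    exact hz (this ▸ w.2)

theorem sSup_reesDepthSet_eq_one {I : Ideal (MvPolynomial (Fin 2) k)} {n : ℕ}
    {g : MvPolynomial (Fin 2) k} (hg : g ∉ I ^ n)
    (hm : ∀ a ∈ Ideal.span {(X 0 : MvPolynomial (Fin 2) k), X 1}, a * g ∈ I ^ n)
    (hI : ∀ a ∈ I, a * g ∈ I ^ (n + 1)) : sSup (reesDepthSet I) = 1 := by
  refine IsGreatest.csSup_eq ⟨one_mem_reesDepthSet I, fun m hm' ↦ ?_⟩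
  refine le_one_of_mem_reesDepthSet (z := Polynomial.monomial n g)
    (by rwa [reesAlgebra.monomial_mem]) (fun r hr ↦ ?_) hm'
  rw [mem_reesAlgebra_iff]
  intro i
  rw [← Polynomial.C_mul_X_pow_eq_monomial, ← mul_assoc, Polynomial.coeff_mul_X_pow',
    Polynomial.coeff_mul_C]
  split_ifs with hi
  · obtain ⟨l, rfl⟩ := Nat.exists_eq_add_of_le hi
    rw [Nat.add_sub_cancel_left]
    rcases l with _ | l
    · exact hm _ (mem_reesMax_iff.1 hr)
    · have h1 : (r : Polynomial (MvPolynomial (Fin 2) k)).coeff (l + 1) ∈ I ^ l * I := by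
        rw [← pow_succ]; exact r.2 (l + 1)
      have h2 : ∀ a ∈ I ^ l * I, a * g ∈ I ^ l * I ^ (n + 1) := fun a ha ↦ by
        refine Submodule.mul_induction_on ha (fun x hx y hy ↦ ?_) fun x y hx hy ↦ ?_
        · rw [mul_assoc]; exact Ideal.mul_mem_mul hx (hI y hy)
        · rw [add_mul]; exact add_mem hx hy
      have h3 := h2 _ h1
      rwa [← pow_add, show l + (n + 1) = n + (l + 1) by ring] at h3
  · exact zero_mem _

end Depth

section Forms

variable {A : Type*} [CommRing A]

/-- The exponent vector of `x ^ a * y ^ b`. -/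
def binaryExponent (a b : ℕ) : Fin 2 →₀ ℕ := Finsupp.single 0 a + Finsupp.single 1 b

theorem C_mul_X_pow_mul_X_pow (c : A) (a b : ℕ) :
    (C c * X 0 ^ a * X 1 ^ b : MvPolynomial (Fin 2) A) = monomial (binaryExponent a b) c := by
  rw [X_pow_eq_monomial, X_pow_eq_monomial, C_mul_monomial, monomial_mul, binaryExponent]
  simp

theorem MvPolynomial.IsHomogeneous.eq_sum_fin_two {D : ℕ} {h : MvPolynomial (Fin 2) A}
    (hh : h.IsHomogeneous D) :
    h = ∑ l : Fin (D + 1),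
      C (coeff (binaryExponent l (D - l)) h) * X 0 ^ (l : ℕ) * X 1 ^ (D - (l : ℕ)) := by
  ext m
  simp only [C_mul_X_pow_mul_X_pow, coeff_sum, coeff_monomial]
  by_cases hm : m.degree = D
  · have hm' : m 0 + m 1 = D := by
      rw [← hm, Finsupp.degree_eq_sum, Fin.sum_univ_two]
    have hmD : m = binaryExponent (m 0) (D - m 0) := by
      ext i; fin_cases i <;> simp [binaryExponent]; omega
    rw [Finset.sum_eq_single ⟨m 0, by omega⟩]
    · rw [if_pos hmD.symm, ← hmD]
    · intro l _ hl
      rw [if_neg]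
      rintro rfl
      exact hl (Fin.ext (by simp [binaryExponent]))
    · simp
  · rw [hh.coeff_eq_zero hm, Finset.sum_eq_zero]
    intro l _
    rw [if_neg]
    rintro rfl
    apply hm
    rw [binaryExponent, map_add, Finsupp.degree_single, Finsupp.degree_single]
    omega

theorem isHomogeneous_C_mul_X_pow_mul_X_pow (c : A) {a b D : ℕ} (h : a + b = D) :
    (C c * X 0 ^ a * X 1 ^ b : MvPolynomial (Fin 2) A).IsHomogeneous D := by
  rw [C_mul_X_pow_mul_X_pow]
  exact isHomogeneous_monomial _ (by simp [binaryExponent, h])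

theorem MvPolynomial.IsHomogeneous.exists_eq_add_X_mul {e : ℕ} {h : MvPolynomial (Fin 2) A}
    (hh : h.IsHomogeneous (e + 1)) :
    ∃ c : A, ∃ h' : MvPolynomial (Fin 2) A,
      h'.IsHomogeneous e ∧ h = C c * X 1 ^ (e + 1) + X 0 * h' := by
  refine ⟨coeff (binaryExponent 0 (e + 1)) h,
    ∑ l : Fin (e + 1), C (coeff (binaryExponent (l + 1) (e - l)) h) * X 0 ^ (l : ℕ) *
      X 1 ^ (e - (l : ℕ)),
    IsHomogeneous.sum _ _ _ fun l _ ↦ isHomogeneous_C_mul_X_pow_mul_X_pow _ (by omega), ?_⟩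
  conv_lhs => rw [hh.eq_sum_fin_two, Fin.sum_univ_succ]
  simp only [Fin.val_zero, pow_zero, mul_one, Nat.sub_zero, Fin.val_succ, Finset.mul_sum,
    Nat.add_sub_add_right]
  congr 1
  refine Finset.sum_congr rfl fun l _ ↦ ?_
  ring

theorem span_pair_pow_le {x y : A} {J : Ideal A} {n : ℕ}
    (h : ∀ l ≤ n, x ^ l * y ^ (n - l) ∈ J) : Ideal.span {x, y} ^ n ≤ J := by
  intro p hp
  rw [show ({x, y} : Set A) = Set.range ![x, y] by simp [Set.pair_comm],
    Ideal.mem_span_pow_iff_exists_isHomogeneous] at hp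
  obtain ⟨q, hq, rfl⟩ := hp
  rw [hq.eq_sum_fin_two, map_sum]
  refine sum_mem fun l _ ↦ ?_
  simp only [map_mul, map_pow, eval_C, eval_X, Matrix.cons_val_zero, Matrix.cons_val_one, mul_assoc]
  exact J.mul_mem_left _ (h l (by omega))

theorem MvPolynomial.IsHomogeneous.mem_span_X_pow {D : ℕ} {h : MvPolynomial (Fin 2) A}
    (hh : h.IsHomogeneous D) : h ∈ Ideal.span {(X 0 : MvPolynomial (Fin 2) A), X 1} ^ D := by
  rw [hh.eq_sum_fin_two]
  refine sum_mem fun l _ ↦ ?_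
  rw [mul_assoc]
  refine Ideal.mul_mem_left _ _ ?_
  rw [show Ideal.span {(X 0 : MvPolynomial (Fin 2) A), X 1} ^ D =
    Ideal.span {(X 0 : MvPolynomial (Fin 2) A), X 1} ^ (l : ℕ) *
      Ideal.span {(X 0 : MvPolynomial (Fin 2) A), X 1} ^ (D - l) by
    rw [← pow_add]; congr 1; omega]
  exact Ideal.mul_mem_mul (Ideal.pow_mem_pow (Ideal.subset_span (by simp)) _)
    (Ideal.pow_mem_pow (Ideal.subset_span (by simp)) _)

/-- A binary form of degree `e` which is monic in `y`. -/
def IsMonicForm (e : ℕ) (h : MvPolynomial (Fin 2) A) : Prop :=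
  h.IsHomogeneous e ∧ aeval (![0, X 1] : Fin 2 → MvPolynomial (Fin 2) A) h = X 1 ^ e

theorem IsMonicForm.mul {e e' : ℕ} {h h' : MvPolynomial (Fin 2) A} (H : IsMonicForm e h)
    (H' : IsMonicForm e' h') : IsMonicForm (e + e') (h * h') :=
  ⟨H.1.mul H'.1, by rw [map_mul, H.2, H'.2, pow_add]⟩

theorem IsMonicForm.pow {e : ℕ} {h : MvPolynomial (Fin 2) A} (H : IsMonicForm e h) (n : ℕ) :
    IsMonicForm (e * n) (h ^ n) :=
  ⟨H.1.pow n, by rw [map_pow, H.2, pow_mul]⟩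

theorem isMonicForm_X_pow (n : ℕ) : IsMonicForm n (X 1 ^ n : MvPolynomial (Fin 2) A) :=
  ⟨isHomogeneous_X_pow 1 n, by simp⟩

theorem IsMonicForm.exists_eq_add_X_mul [Nontrivial A] {e : ℕ} {g : MvPolynomial (Fin 2) A}
    (hg : IsMonicForm (e + 1) g) :
    ∃ g' : MvPolynomial (Fin 2) A, g'.IsHomogeneous e ∧ g = X 1 ^ (e + 1) + X 0 * g' := by
  obtain ⟨c, g', hg', rfl⟩ := hg.1.exists_eq_add_X_mul
  refine ⟨g', hg', ?_⟩
  have := hg.2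
  simp only [map_add, map_mul, map_pow, aeval_X, aeval_C, algebraMap_eq, Matrix.cons_val_zero,
    Matrix.cons_val_one, zero_mul, add_zero] at this
  rw [this]

/-- An ideal containing `x ^ (D - e)` times a form of degree `e` monic in `y`, for each `e ≤ D`,
contains all forms of degree `D`. -/
theorem span_X_pow_le_of_isMonicForm [Nontrivial A] {J : Ideal (MvPolynomial (Fin 2) A)} {D : ℕ}
    (hJ : ∀ e ≤ D, ∃ g : MvPolynomial (Fin 2) A, IsMonicForm e g ∧ X 0 ^ (D - e) * g ∈ J) :
    Ideal.span {(X 0 : MvPolynomial (Fin 2) A), X 1} ^ D ≤ J := by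
  have key : ∀ e ≤ D, ∀ h : MvPolynomial (Fin 2) A, h.IsHomogeneous e → X 0 ^ (D - e) * h ∈ J := by
    intro e
    induction e with
    | zero =>
      intro _ h hh
      obtain ⟨g, hg, hgJ⟩ := hJ 0 (Nat.zero_le _)
      have h1 : ∀ p : MvPolynomial (Fin 2) A, p.IsHomogeneous 0 → ∃ c, p = C c := fun p hp ↦
        ⟨_, totalDegree_eq_zero_iff_eq_C.1 ((totalDegree_zero_iff_isHomogeneous _).2 hp)⟩
      obtain ⟨c, rfl⟩ := h1 g hg.1
      obtain ⟨c', rfl⟩ := h1 h hh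
      have := hg.2
      simp only [aeval_C, algebraMap_eq, pow_zero] at this
      rw [this, mul_one] at hgJ
      exact J.mul_mem_right _ hgJ
    | succ e ih =>
      intro he h hh
      obtain ⟨g, hg, hgJ⟩ := hJ (e + 1) he
      obtain ⟨g', hg', rfl⟩ := hg.exists_eq_add_X_mul
      obtain ⟨c, h', hh', rfl⟩ := hh.exists_eq_add_X_mul
      have h2 := ih (by omega) (h' - C c * g') (hh'.sub (hg'.C_mul c))
      rw [show D - e = D - (e + 1) + 1 by omega, pow_succ] at h2
      convert add_mem (J.mul_mem_left (C c) hgJ) h2 using 1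
      ring
  refine span_pair_pow_le fun l hl ↦ ?_
  have := key (D - l) (by omega) _ (isHomogeneous_X_pow 1 _)
  rwa [show D - (D - l) = l by omega] at this

end Forms

section NodalCurve

variable {A : Type*} [CommRing A]

/-- The homogenized Chebyshev-like recurrence `s₀ = 0`, `s₁ = y`, `sₙ₊₂ = y sₙ₊₁ - x² sₙ`. -/
def chebyshevForm (A : Type*) [CommRing A] : ℕ → MvPolynomial (Fin 2) A
  | 0 => 0
  | 1 => X 1
  | n + 2 => X 1 * chebyshevForm A (n + 1) - X 0 ^ 2 * chebyshevForm A n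

theorem isHomogeneous_chebyshevForm (n : ℕ) : (chebyshevForm A n).IsHomogeneous n := by
  induction n using Nat.twoStepInduction with
  | zero => exact isHomogeneous_zero _ _ _
  | one => exact isHomogeneous_X _ _
  | more n h0 h1 =>
    rw [chebyshevForm]
    refine IsHomogeneous.sub ?_ ?_
    · convert (isHomogeneous_X A (1 : Fin 2)).mul h1 using 1; ring
    · convert (isHomogeneous_X_pow (R := A) (0 : Fin 2) 2).mul h0 using 1; ring

theorem isMonicForm_chebyshevForm (n : ℕ) : IsMonicForm (n + 1) (chebyshevForm A (n + 1)) := by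
  refine ⟨isHomogeneous_chebyshevForm _, ?_⟩
  induction n with
  | zero => simp [chebyshevForm]
  | succ n ih =>
    rw [chebyshevForm, map_sub, map_mul, map_mul, ih]
    simp [pow_succ']

theorem chebyshevForm_quadratic (n : ℕ) :
    chebyshevForm A (n + 1) ^ 2 - X 1 * chebyshevForm A (n + 1) * chebyshevForm A n
      + X 0 ^ 2 * chebyshevForm A n ^ 2 = X 0 ^ (2 * n) * X 1 ^ 2 := by
  induction n with
  | zero => simp [chebyshevForm]
  | succ n ih =>
    rw [show chebyshevForm A (n + 1 + 1) =
      X 1 * chebyshevForm A (n + 1) - X 0 ^ 2 * chebyshevForm A n from rfl]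
    linear_combination X 0 ^ 2 * ih

/-- The ideal of the forms `x ^ d`, `x s_{d-1}`, `s_d`, which parametrize a rational plane curve
whose only singularities are double points. -/
def chebyshevIdeal (A : Type*) [CommRing A] (d : ℕ) : Ideal (MvPolynomial (Fin 2) A) :=
  Ideal.span {X 0 ^ d, X 0 * chebyshevForm A (d - 1), chebyshevForm A d}

theorem X_zero_pow_mem_chebyshevIdeal (d : ℕ) : X 0 ^ d ∈ chebyshevIdeal A d :=
  Ideal.subset_span (by simp)

theorem X_zero_mul_mem_chebyshevIdeal (d : ℕ) :
    X 0 * chebyshevForm A (d - 1) ∈ chebyshevIdeal A d :=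
  Ideal.subset_span (by simp)

theorem chebyshevForm_mem_chebyshevIdeal (d : ℕ) : chebyshevForm A d ∈ chebyshevIdeal A d :=
  Ideal.subset_span (by simp)

theorem span_X_pow_le_chebyshevIdeal_mul [Nontrivial A] (e : ℕ) :
    Ideal.span {(X 0 : MvPolynomial (Fin 2) A), X 1} ^ (2 * e + 1) ≤
      chebyshevIdeal A (e + 1) * Ideal.span {(X 0 : MvPolynomial (Fin 2) A), X 1} ^ e := by
  refine span_X_pow_le_of_isMonicForm fun i hi ↦ ?_
  rcases le_or_gt i e with h | h
  · refine ⟨X 1 ^ i, isMonicForm_X_pow i, ?_⟩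
    rw [show 2 * e + 1 - i = (e + 1) + (e - i) by omega, pow_add, mul_assoc]
    refine Ideal.mul_mem_mul (X_zero_pow_mem_chebyshevIdeal _) (IsHomogeneous.mem_span_X_pow ?_)
    convert (isHomogeneous_X_pow (R := A) (0 : Fin 2) (e - i)).mul
      (isHomogeneous_X_pow (R := A) (1 : Fin 2) i) using 1
    omega
  · obtain ⟨t, rfl⟩ := Nat.exists_eq_add_of_lt h
    refine ⟨chebyshevForm A (e + 1) * X 1 ^ t, ?_, ?_⟩
    · convert (isMonicForm_chebyshevForm (A := A) e).mul (isMonicForm_X_pow t) using 1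
      ring
    · rw [show 2 * e + 1 - (e + t + 1) = e - t by omega, mul_left_comm]
      refine Ideal.mul_mem_mul (chebyshevForm_mem_chebyshevIdeal _)
        (IsHomogeneous.mem_span_X_pow ?_)
      convert (isHomogeneous_X_pow (R := A) (0 : Fin 2) (e - t)).mul
        (isHomogeneous_X_pow (R := A) (1 : Fin 2) t) using 1
      omega

theorem span_singleton_mul_span_X_le (e : ℕ) :
    Ideal.span {(X 0 ^ (2 * e + 1) * X 1 : MvPolynomial (Fin 2) A)} *
        Ideal.span {(X 0 : MvPolynomial (Fin 2) A), X 1} ≤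
      chebyshevIdeal A (e + 1) ^ 2 * Ideal.span {(X 0 : MvPolynomial (Fin 2) A), X 1} := by
  have h1 := X_zero_pow_mem_chebyshevIdeal (A := A) (e + 1)
  have h2 := X_zero_mul_mem_chebyshevIdeal (A := A) (e + 1)
  have h3 := chebyshevForm_mem_chebyshevIdeal (A := A) (e + 1)
  rw [Nat.add_sub_cancel] at h2
  have hx : (X 0 : MvPolynomial (Fin 2) A) ∈ Ideal.span {(X 0 : MvPolynomial (Fin 2) A), X 1} :=
    Ideal.subset_span (by simp)
  have hy : (X 1 : MvPolynomial (Fin 2) A) ∈ Ideal.span {(X 0 : MvPolynomial (Fin 2) A), X 1} :=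
    Ideal.subset_span (by simp)
  rw [Ideal.span_mul_span', Ideal.span_le, pow_two]
  rintro _ ⟨_, rfl, p, hp, rfl⟩
  change X 0 ^ (2 * e + 1) * X 1 * p ∈
    chebyshevIdeal A (e + 1) * chebyshevIdeal A (e + 1) * Ideal.span {X 0, X 1}
  rcases hp with rfl | rfl
  · convert Ideal.mul_mem_mul (Ideal.mul_mem_mul h1 h1) hy using 1
    ring
  · convert sub_mem (add_mem (Ideal.mul_mem_mul (Ideal.mul_mem_mul h3 h3) hx)
      (Ideal.mul_mem_mul (Ideal.mul_mem_mul h2 h2) hx))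
      (Ideal.mul_mem_mul (Ideal.mul_mem_mul h3 h2) hy) using 1
    have := chebyshevForm_quadratic (A := A) e
    linear_combination (-X 0) * this

theorem pow_mul_le_pow_mul {H J K : Ideal A} (h : H * K ≤ J ^ 2 * K) (n : ℕ) :
    H ^ n * K ≤ J ^ (2 * n) * K := by
  induction n with
  | zero => simp
  | succ n ih =>
    calc H ^ (n + 1) * K = H * (H ^ n * K) := by ring
      _ ≤ H * (J ^ (2 * n) * K) := Ideal.mul_mono_right ih
      _ = J ^ (2 * n) * (H * K) := by ring
      _ ≤ J ^ (2 * n) * (J ^ 2 * K) := Ideal.mul_mono_right h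
      _ = J ^ (2 * (n + 1)) * K := by ring

theorem X_pow_mul_X_pow_mem_chebyshevIdeal_pow (e b : ℕ) :
    (X 0 ^ ((2 * e + 1) * b + 1) * X 1 ^ b : MvPolynomial (Fin 2) A) ∈
      chebyshevIdeal A (e + 1) ^ (2 * b) := by
  have h := pow_mul_le_pow_mul (span_singleton_mul_span_X_le (A := A) e) b
  rw [Ideal.span_singleton_pow] at h
  have hx : (X 0 : MvPolynomial (Fin 2) A) ∈ Ideal.span {(X 0 : MvPolynomial (Fin 2) A), X 1} :=
    Ideal.subset_span (by simp)
  have hmem := Ideal.mul_le_left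
    (h (Ideal.mul_mem_mul (Ideal.mem_span_singleton_self _) hx))
  convert hmem using 1
  ring

theorem span_X_pow_le_chebyshevIdeal_pow [Nontrivial A] (e : ℕ) :
    Ideal.span {(X 0 : MvPolynomial (Fin 2) A), X 1} ^
        (2 * (e + 2) ^ 2 * (e + 2) + 1) ≤ chebyshevIdeal A (e + 2) ^ (2 * (e + 2) ^ 2) := by
  set N := 2 * (e + 2) ^ 2 with hN
  refine span_X_pow_le_of_isMonicForm fun b hb ↦ ?_
  rcases le_or_gt (2 * b) N with h | h
  · refine ⟨X 1 ^ b, isMonicForm_X_pow b, ?_⟩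
    obtain ⟨t, ht⟩ := Nat.exists_eq_add_of_le h
    have h1 := Ideal.mul_mem_mul (X_pow_mul_X_pow_mem_chebyshevIdeal_pow (A := A) (e + 1) b)
      (Ideal.pow_mem_pow (X_zero_pow_mem_chebyshevIdeal (A := A) (e + 2)) t)
    rw [← pow_add, ← ht] at h1
    have hexp : N * (e + 2) + 1 - b = (2 * (e + 1) + 1) * b + 1 + (e + 2) * t := by
      rw [Nat.sub_eq_iff_eq_add hb, ht]
      ring
    rw [hexp]
    convert h1 using 1
    ring
  · -- `m` is the number of factors different from `x ^ d`, and `i` of these are `x s_{d-1}`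
    have hb1 : (e + 2) * (e + 1) ≤ b := by nlinarith
    obtain ⟨m, hm1, hm2, hmN⟩ : ∃ m, b ≤ m * (e + 2) + 1 ∧ m * (e + 1) ≤ b ∧ m ≤ N := by
      refine ⟨(b + e) / (e + 2), ?_, ?_, ?_⟩
      · have h1 := Nat.div_add_mod (b + e) (e + 2)
        have h2 := Nat.mod_lt (b + e) (show 0 < e + 2 by omega)
        rw [mul_comm] at h1
        omega
      · have h1 := Nat.div_mul_le_self (b + e) (e + 2)
        by_contra! h2
        nlinarith
      · refine Nat.lt_succ_iff.1 ((Nat.div_lt_iff_lt_mul (by omega)).2 ?_)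
        rw [Nat.succ_eq_add_one, add_mul]
        omega
    obtain ⟨i, ε, hε, hi, hbi⟩ : ∃ i ε, ε ≤ 1 ∧ i ≤ m ∧ b + i = m * (e + 2) + ε := by
      rcases hm1.eq_or_lt with h' | h'
      · exact ⟨0, 1, le_rfl, Nat.zero_le _, by omega⟩
      · refine ⟨m * (e + 2) - b, 0, by omega, ?_, by omega⟩
        rw [mul_add] at *
        omega
    obtain ⟨j, rfl⟩ := Nat.exists_eq_add_of_le hi
    obtain ⟨l, hl⟩ := Nat.exists_eq_add_of_le hmN
    refine ⟨chebyshevForm A (e + 1) ^ i * chebyshevForm A (e + 2) ^ j * X 1 ^ ε, ?_, ?_⟩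
    · convert (((isMonicForm_chebyshevForm (A := A) e).pow i).mul
        ((isMonicForm_chebyshevForm (A := A) (e + 1)).pow j)).mul (isMonicForm_X_pow ε) using 1
      have : b + i = ((e + 1) * i + (e + 1 + 1) * j + ε) + i := by rw [hbi]; ring
      omega
    · have h1 := Ideal.mul_mem_mul (Ideal.mul_mem_mul
        (Ideal.pow_mem_pow (X_zero_mul_mem_chebyshevIdeal (A := A) (e + 2)) i)
        (Ideal.pow_mem_pow (chebyshevForm_mem_chebyshevIdeal (A := A) (e + 2)) j))
        (Ideal.pow_mem_pow (X_zero_pow_mem_chebyshevIdeal (A := A) (e + 2)) l)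
      rw [← pow_add, ← pow_add, ← hl] at h1
      have hD : N * (e + 2) + 1 - b = (e + 2) * l + i + (1 - ε) := by
        have : N * (e + 2) + 1 + i = (i + j) * (e + 2) + (e + 2) * l + 1 + i := by rw [hl]; ring
        omega
      rw [hD]
      convert Ideal.mul_mem_left _ (X 0 ^ (1 - ε) * X 1 ^ ε) h1 using 1
      rw [show e + 2 - 1 = e + 1 by omega]
      ring

end NodalCurve

section Genericity

variable {k : Type*} [Field k]

theorem MvPolynomial.IsHomogeneous.exists_formOf_eq {D : ℕ} {h : MvPolynomial (Fin 2) k}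
    (hh : h.IsHomogeneous D) : ∃ c, formOf D c = h :=
  ⟨_, hh.eq_sum_fin_two.symm⟩

theorem isHomogeneous_formOf (d : ℕ) (c : Fin (d + 1) → k) : (formOf d c).IsHomogeneous d :=
  IsHomogeneous.sum _ _ _ fun _ _ ↦ isHomogeneous_C_mul_X_pow_mul_X_pow _ (by omega)

attribute [local instance] MvPolynomial.gradedAlgebra

/-- For a homogeneous ideal over a polynomial ring of parameters, the condition that a
specialization contains all forms of degree `D` is open. -/
theorem exists_polynomial_span_X_pow_le_map {τ : Type*}
    {I : Ideal (MvPolynomial (Fin 2) (MvPolynomial τ k))}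
    (hI : I.IsHomogeneous (homogeneousSubmodule (Fin 2) (MvPolynomial τ k))) {D : ℕ} {c₀ : τ → k}
    (h₀ : Ideal.span {(X 0 : MvPolynomial (Fin 2) k), X 1} ^ D ≤ I.map (map (eval c₀))) :
    ∃ P : MvPolynomial τ k, eval c₀ P ≠ 0 ∧ ∀ c, eval c P ≠ 0 →
      Ideal.span {(X 0 : MvPolynomial (Fin 2) k), X 1} ^ D ≤ I.map (map (eval c)) := by
  have hsurj : Function.Surjective (map (σ := Fin 2) (eval c₀)) :=
    map_surjective _ fun a ↦ ⟨C a, by simp⟩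
  have hG : ∀ j : Fin (D + 1), ∃ G ∈ I, G.IsHomogeneous D ∧
      map (eval c₀) G = monomial (binaryExponent (j : ℕ) (D - j)) (1 : k) := by
    intro j
    have hj : (monomial (binaryExponent (j : ℕ) (D - j)) (1 : k)).IsHomogeneous D := by
      rw [← C_mul_X_pow_mul_X_pow]
      exact isHomogeneous_C_mul_X_pow_mul_X_pow _ (by omega)
    obtain ⟨G, hGI, hG⟩ := (Ideal.mem_map_iff_of_surjective _ hsurj).1 (h₀ hj.mem_span_X_pow)
    refine ⟨homogeneousComponent D G, homogeneousComponent_mem_of_mem hI hGI D,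
      homogeneousComponent_isHomogeneous D G, ?_⟩
    rw [← hG] at hj ⊢
    rw [← homogeneousComponent_eq_self hj]
    ext m
    simp only [coeff_map, coeff_homogeneousComponent]
    split_ifs <;> simp
  choose G hGI hGhom hG using hG
  let M : Matrix (Fin (D + 1)) (Fin (D + 1)) (MvPolynomial τ k) :=
    .of fun i j ↦ coeff (binaryExponent (j : ℕ) (D - j)) (G i)
  refine ⟨M.det, ?_, fun c hc ↦ ?_⟩
  · have : (eval c₀).mapMatrix M = 1 := by
      ext i j
      simp only [M, RingHom.mapMatrix_apply, Matrix.map_apply, Matrix.of_apply, ← coeff_map, hG,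
        coeff_monomial, Matrix.one_apply]
      congr 1
      refine propext ⟨fun h ↦ Fin.ext ?_, fun h ↦ h ▸ rfl⟩
      simpa [binaryExponent] using DFunLike.congr_fun h 0
    rw [RingHom.map_det, this, Matrix.det_one]
    exact one_ne_zero
  · rw [RingHom.map_det] at hc
    set B := (eval c).mapMatrix M with hB
    have hinv : B⁻¹ * B = 1 := Matrix.nonsing_inv_mul _ (isUnit_iff_ne_zero.2 hc)
    have hexp : ∀ i, map (eval c) (G i) =
        ∑ j : Fin (D + 1), C (B i j) * (X 0 ^ (j : ℕ) * X 1 ^ (D - (j : ℕ))) := by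
      intro i
      rw [((hGhom i).map (eval c)).eq_sum_fin_two]
      refine Finset.sum_congr rfl fun j _ ↦ ?_
      rw [mul_assoc, coeff_map]
      rfl
    refine span_pair_pow_le fun l hl ↦ ?_
    have hmon : (X 0 ^ l * X 1 ^ (D - l) : MvPolynomial (Fin 2) k) =
        ∑ i, C (B⁻¹ ⟨l, by omega⟩ i) * map (eval c) (G i) := by
      simp only [hexp, Finset.mul_sum]
      rw [Finset.sum_comm]
      simp only [← mul_assoc, ← C_mul, ← Finset.sum_mul, ← map_sum, ← Matrix.mul_apply, hinv]
      rw [Finset.sum_eq_single ⟨l, by omega⟩]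
      · simp
      · intro j _ hj
        rw [Matrix.one_apply_ne hj.symm]
        simp
      · simp
    rw [hmon]
    exact sum_mem fun i _ ↦ Ideal.mul_mem_left _ _ (Ideal.mem_map_of_mem _ (hGI i))

/-- The form of degree `d` whose coefficients are the `i`-th family of parameters. -/
def genericForm (k : Type*) [Field k] {n : ℕ} (d : ℕ) (i : Fin n) :
    MvPolynomial (Fin 2) (MvPolynomial (Fin n × Fin (d + 1)) k) :=
  ∑ l : Fin (d + 1), C (X (i, l)) * X 0 ^ (l : ℕ) * X 1 ^ (d - (l : ℕ))

theorem isHomogeneous_genericForm {n : ℕ} (d : ℕ) (i : Fin n) :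
    (genericForm k d i).IsHomogeneous d :=
  IsHomogeneous.sum _ _ _ fun _ _ ↦ isHomogeneous_C_mul_X_pow_mul_X_pow _ (by omega)

theorem map_genericForm {n : ℕ} (d : ℕ) (i : Fin n) (c : Fin n × Fin (d + 1) → k) :
    map (eval c) (genericForm k d i) = formOf d fun l ↦ c (i, l) := by
  simp [genericForm, formOf]

theorem isHomogeneous_span_X {A : Type*} [CommRing A] :
    (Ideal.span {(X 0 : MvPolynomial (Fin 2) A), X 1}).IsHomogeneous
      (homogeneousSubmodule (Fin 2) A) := by
  refine Ideal.homogeneous_span _ _ ?_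
  rintro _ (rfl | rfl) <;> exact ⟨1, isHomogeneous_X _ _⟩

theorem MvPolynomial.isHomogeneous_ideal_pow {σ A : Type*} [CommRing A]
    {I : Ideal (MvPolynomial σ A)} (hI : I.IsHomogeneous (homogeneousSubmodule σ A)) (n : ℕ) :
    (I ^ n).IsHomogeneous (homogeneousSubmodule σ A) := by
  induction n with
  | zero => rw [pow_zero, Ideal.one_eq_top]; exact Ideal.IsHomogeneous.top _
  | succ n ih => rw [pow_succ]; exact ih.mul hI

/-- If one triple of forms `f` of degree `d` has `𝔪 ^ D ⊆ (f) ^ a 𝔪 ^ b`, then so does the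
general one. -/
theorem exists_polynomial_span_X_pow_le {d a b D : ℕ} {c₀ : Fin 3 → Fin (d + 1) → k}
    (h₀ : Ideal.span {(X 0 : MvPolynomial (Fin 2) k), X 1} ^ D ≤
      Ideal.span {formOf d (c₀ 0), formOf d (c₀ 1), formOf d (c₀ 2)} ^ a *
        Ideal.span {(X 0 : MvPolynomial (Fin 2) k), X 1} ^ b) :
    ∃ P : MvPolynomial (Fin 3 × Fin (d + 1)) k, eval (fun p ↦ c₀ p.1 p.2) P ≠ 0 ∧
      ∀ c : Fin 3 → Fin (d + 1) → k, eval (fun p ↦ c p.1 p.2) P ≠ 0 →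
        Ideal.span {(X 0 : MvPolynomial (Fin 2) k), X 1} ^ D ≤
          Ideal.span {formOf d (c 0), formOf d (c 1), formOf d (c 2)} ^ a *
            Ideal.span {(X 0 : MvPolynomial (Fin 2) k), X 1} ^ b := by
  set I : Ideal (MvPolynomial (Fin 2) (MvPolynomial (Fin 3 × Fin (d + 1)) k)) :=
    Ideal.span {genericForm k d 0, genericForm k d 1, genericForm k d 2} ^ a *
      Ideal.span {X 0, X 1} ^ b
  have hI : I.IsHomogeneous (homogeneousSubmodule _ _) := by
    refine .mul (isHomogeneous_ideal_pow (Ideal.homogeneous_span _ _ ?_) a)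
      (isHomogeneous_ideal_pow isHomogeneous_span_X b)
    rintro _ (rfl | rfl | rfl) <;> exact ⟨d, isHomogeneous_genericForm d _⟩
  have hmap : ∀ c : Fin 3 → Fin (d + 1) → k, I.map (map (eval fun p ↦ c p.1 p.2)) =
      Ideal.span {formOf d (c 0), formOf d (c 1), formOf d (c 2)} ^ a *
        Ideal.span {(X 0 : MvPolynomial (Fin 2) k), X 1} ^ b := by
    intro c
    simp only [I, Ideal.map_mul, Ideal.map_pow, Ideal.map_span, Set.image_insert_eq,
      Set.image_singleton, map_genericForm, map_X]
  rw [← hmap] at h₀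
  obtain ⟨P, hP₀, hP⟩ := exists_polynomial_span_X_pow_le_map hI h₀
  exact ⟨P, hP₀, fun c hc ↦ hmap c ▸ hP _ hc⟩

end Genericity

section Genericity

variable {k : Type*} [Field k]

theorem exists_span_formOf_eq_chebyshevIdeal (k : Type*) [Field k] (d : ℕ) :
    ∃ c : Fin 3 → Fin (d + 2) → k,
      Ideal.span {formOf (d + 1) (c 0), formOf (d + 1) (c 1), formOf (d + 1) (c 2)} =
        chebyshevIdeal k (d + 1) := by
  obtain ⟨c₀, h₀⟩ := (isHomogeneous_X_pow (R := k) (0 : Fin 2) (d + 1)).exists_formOf_eq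
  obtain ⟨c₁, h₁⟩ : ∃ c, formOf (d + 1) c = X 0 * chebyshevForm k d := by
    apply IsHomogeneous.exists_formOf_eq
    rw [add_comm]
    exact (isHomogeneous_X k (0 : Fin 2)).mul (isHomogeneous_chebyshevForm d)
  obtain ⟨c₂, h₂⟩ := (isHomogeneous_chebyshevForm (A := k) (d + 1)).exists_formOf_eq
  exact ⟨![c₀, c₁, c₂], by simp [h₀, h₁, h₂, chebyshevIdeal]⟩

open Module in
/-- Three forms of degree `d ≥ 5` generate an ideal which does not contain all forms of
degree `d + 1`. -/
theorem not_span_X_pow_le_span_formOf {d : ℕ} (hd : 5 ≤ d) (c : Fin 3 → Fin (d + 1) → k) :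
    ¬ Ideal.span {(X 0 : MvPolynomial (Fin 2) k), X 1} ^ (d + 1) ≤
      Ideal.span {formOf d (c 0), formOf d (c 1), formOf d (c 2)} := by
  intro h
  let v : Fin 3 × Fin 2 → MvPolynomial (Fin 2) k := fun p ↦ X p.2 * formOf d (c p.1)
  have hcomp : ∀ a : MvPolynomial (Fin 2) k, ∀ i : Fin 3,
      homogeneousComponent (d + 1) (a * formOf d (c i)) ∈ Submodule.span k (Set.range v) := by
    intro a i
    induction a using MvPolynomial.induction_on' with
    | add p q hp hq => rw [add_mul, map_add]; exact add_mem hp hq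
    | monomial m r =>
      have hm := (isHomogeneous_monomial (σ := Fin 2) r (rfl : m.degree = m.degree)).mul
        (isHomogeneous_formOf d (c i))
      rw [homogeneousComponent_of_mem hm]
      split_ifs with hdeg
      · have h1 : (monomial m r : MvPolynomial (Fin 2) k).IsHomogeneous 1 :=
          isHomogeneous_monomial r (by omega)
        obtain ⟨r₀, h', hh', heq⟩ := IsHomogeneous.exists_eq_add_X_mul h1
        obtain ⟨r₁, rfl⟩ : ∃ r₁, h' = C r₁ :=
          ⟨_, totalDegree_eq_zero_iff_eq_C.1 ((totalDegree_zero_iff_isHomogeneous _).2 hh')⟩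
        rw [heq, show (C r₀ * X 1 ^ (0 + 1) + X 0 * C r₁) * formOf d (c i) =
          r₀ • v (i, 1) + r₁ • v (i, 0) by simp only [v, smul_eq_C_mul]; ring]
        exact add_mem (Submodule.smul_mem _ _ (Submodule.subset_span ⟨_, rfl⟩))
          (Submodule.smul_mem _ _ (Submodule.subset_span ⟨_, rfl⟩))
      · exact zero_mem _
  let w : Fin (d + 2) → MvPolynomial (Fin 2) k :=
    fun l ↦ monomial (binaryExponent l (d + 1 - l)) 1
  have hw : ∀ l, w l ∈ Submodule.span k (Set.range v) := by
    intro l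
    have hl : (w l).IsHomogeneous (d + 1) := by
      simp only [w, ← C_mul_X_pow_mul_X_pow]
      exact isHomogeneous_C_mul_X_pow_mul_X_pow _ (by omega)
    have hmem := h hl.mem_span_X_pow
    rw [← homogeneousComponent_eq_self hl]
    rw [Ideal.mem_span_insert] at hmem
    obtain ⟨a₀, z, hz, h₀⟩ := hmem
    obtain ⟨a₁, a₂, rfl⟩ := Ideal.mem_span_pair.1 hz
    rw [h₀, map_add, map_add]
    exact add_mem (hcomp _ _) (add_mem (hcomp _ _) (hcomp _ _))
  have hli : LinearIndependent k w := by
    have := (basisMonomials (Fin 2) k).linearIndependent.comp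
      (fun l : Fin (d + 2) ↦ binaryExponent l (d + 1 - l)) (fun a b hab ↦ Fin.ext (by
        simpa [binaryExponent] using DFunLike.congr_fun hab 0))
    simpa [w, Function.comp_def] using this
  have h1 := finrank_span_eq_card hli
  have h2 : Submodule.span k (Set.range w) ≤ Submodule.span k (Set.range v) :=
    Submodule.span_le.2 (by rintro _ ⟨l, rfl⟩; exact hw l)
  have := FiniteDimensional.span_of_finite k (Set.finite_range v)
  have h3 := Submodule.finrank_mono h2
  have h4 := finrank_range_le_card (R := k) v
  simp only [Set.finrank, Fintype.card_prod, Fintype.card_fin] at h1 h4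
  omega

end Genericity

section Saturation

variable {A : Type*} [CommRing A] {I m : Ideal A} {d : ℕ}

theorem pow_add_le_pow_mul_pow {e : ℕ} (h : m ^ (d + e) ≤ I * m ^ e) (n j : ℕ) (hj : e ≤ j) :
    m ^ (n * d + j) ≤ I ^ n * m ^ j := by
  induction n with
  | zero => simp
  | succ n ih =>
    obtain ⟨t, rfl⟩ := Nat.exists_eq_add_of_le hj
    calc m ^ ((n + 1) * d + (e + t)) = m ^ d * m ^ (n * d + (e + t)) := by ring
      _ ≤ m ^ d * (I ^ n * m ^ (e + t)) := Ideal.mul_mono_right ih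
      _ = I ^ n * m ^ t * m ^ (d + e) := by ring
      _ ≤ I ^ n * m ^ t * (I * m ^ e) := Ideal.mul_mono_right h
      _ = I ^ (n + 1) * m ^ (e + t) := by ring

/-- If `𝔪 ^ (nd + i) ⊆ I ^ n` holds for all but finitely many `i, n ≥ 1`, and not for `i = n = 1`,
then a maximal failure produces an element multiplied into the Rees algebra. -/
theorem exists_notMem_pow_of_pow_le (hI : I ≤ m ^ d) {e N : ℕ} (hN : e ≤ N * d + 1)
    (h₁ : m ^ (d + e) ≤ I * m ^ e) (h₂ : m ^ (N * d + 1) ≤ I ^ N) (h₃ : ¬ m ^ (d + 1) ≤ I) :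
    ∃ n g, g ∉ I ^ n ∧ (∀ a ∈ m, a * g ∈ I ^ n) ∧ ∀ a ∈ I, a * g ∈ I ^ (n + 1) := by
  have hi : ∀ n i, e ≤ i → m ^ (n * d + i) ≤ I ^ n := fun n i hi ↦
    (pow_add_le_pow_mul_pow h₁ n i hi).trans Ideal.mul_le_left
  have hn : ∀ n i, N ≤ n → 1 ≤ i → m ^ (n * d + i) ≤ I ^ n := by
    intro n i hn hi1
    obtain ⟨t, rfl⟩ := Nat.exists_eq_add_of_le hn
    calc m ^ ((N + t) * d + i) ≤ m ^ (t * d + (N * d + 1)) := Ideal.pow_le_pow_right (by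
          rw [add_mul]; omega)
      _ ≤ I ^ t * m ^ (N * d + 1) := pow_add_le_pow_mul_pow h₁ t _ hN
      _ ≤ I ^ t * I ^ N := Ideal.mul_mono_right h₂
      _ = I ^ (N + t) := by ring
  let bad : ℕ → Prop := fun s ↦ ∃ n i, n + i = s ∧ 1 ≤ i ∧ ¬ m ^ (n * d + i) ≤ I ^ n
  have hbound : ∀ s, bad s → s ≤ N + e := by
    rintro s ⟨n, i, rfl, hi1, hbad⟩
    by_contra! hs
    rcases le_or_gt N n with h | h
    · exact hbad (hn n i h hi1)
    · exact hbad (hi n i (by omega))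
  classical
  have hbad2 : bad 2 := ⟨1, 1, rfl, le_rfl, by simpa using h₃⟩
  obtain ⟨n, i, hs, hi1, hbad⟩ := Nat.findGreatest_spec (hbound 2 hbad2) hbad2
  have hmax : ∀ n' i', n + i < n' + i' → 1 ≤ i' → m ^ (n' * d + i') ≤ I ^ n' := by
    intro n' i' hlt hi'
    by_contra hcon
    have hb : bad (n' + i') := ⟨n', i', rfl, hi', hcon⟩
    exact Nat.findGreatest_is_greatest (hs ▸ hlt) (hbound _ hb) hb
  obtain ⟨g, hg, hgI⟩ := Set.not_subset.1 hbad
  refine ⟨n, g, hgI, fun a ha ↦ hmax n (i + 1) (by omega) (by omega) ?_,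
    fun a ha ↦ hmax (n + 1) i (by omega) hi1 ?_⟩
  · rw [show n * d + (i + 1) = 1 + (n * d + i) by ring, pow_add, pow_one]
    exact Ideal.mul_mem_mul ha hg
  · rw [show (n + 1) * d + i = d + (n * d + i) by ring, pow_add]
    exact Ideal.mul_mem_mul (hI ha) hg

end Saturation

/-- **Main theorem.** For an infinite field `k` and `d ≥ 5`, for general forms
`f₁, f₂, f₃` of degree `d` in `R = k[x,y]` (genericity encoded as the nonvanishing locus
of a nonzero polynomial on the parameter space `k^{3(d+1)}`), with `I = (f₁,f₂,f₃)`,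
the Rees algebra `R[It]` of `I` has depth exactly `1` with respect to its graded
maximal ideal `𝓜 = (x, y, ⊕_{ℓ≥1} I^ℓ t^ℓ)`. -/
theorem rees_algebra_of_general_binary_forms_depth_one (k : Type*) [Field k] [Infinite k]
    (d : ℕ) (hd : 5 ≤ d) :
    ∃ P : MvPolynomial (Fin 3 × Fin (d + 1)) k, P ≠ 0 ∧
      ∀ c : Fin 3 → Fin (d + 1) → k,
        eval (fun p => c p.1 p.2) P ≠ 0 →
          sSup (reesDepthSet (Ideal.span {formOf d (c 0), formOf d (c 1), formOf d (c 2)}))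
            = 1 := by
  obtain ⟨e, rfl⟩ : ∃ e, d = e + 2 := ⟨d - 2, by omega⟩
  obtain ⟨c₀, hc₀⟩ := exists_span_formOf_eq_chebyshevIdeal k (e + 1)
  obtain ⟨P, hP₀, hP⟩ := exists_polynomial_span_X_pow_le (c₀ := c₀) (a := 1) (b := e + 1)
    (D := 2 * (e + 1) + 1) (by
      rw [hc₀, pow_one]; exact span_X_pow_le_chebyshevIdeal_mul (A := k) (e + 1))
  obtain ⟨Q, hQ₀, hQ⟩ := exists_polynomial_span_X_pow_le (c₀ := c₀) (a := 2 * (e + 2) ^ 2) (b := 0)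
    (D := 2 * (e + 2) ^ 2 * (e + 2) + 1) (by
      rw [hc₀, pow_zero, mul_one]; exact span_X_pow_le_chebyshevIdeal_pow (A := k) e)
  refine ⟨P * Q, ?_, fun c hc ↦ ?_⟩
  · rintro h
    have := congrArg (eval fun p ↦ c₀ p.1 p.2) h
    rw [map_mul, map_zero] at this
    exact mul_ne_zero hP₀ hQ₀ this
  rw [map_mul] at hc
  have h₁ := hP c (left_ne_zero_of_mul hc)
  have h₂ := hQ c (right_ne_zero_of_mul hc)
  rw [pow_one, show 2 * (e + 1) + 1 = e + 2 + (e + 1) by ring] at h₁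
  rw [pow_zero, mul_one] at h₂
  obtain ⟨n, g, hg, hm, hI⟩ := exists_notMem_pow_of_pow_le (d := e + 2) (by
    rw [Ideal.span_le]
    rintro _ (rfl | rfl | rfl) <;> exact (isHomogeneous_formOf _ _).mem_span_X_pow)
    (by nlinarith) h₁ h₂ (not_span_X_pow_le_span_formOf hd c)
  exact sSup_reesDepthSet_eq_one hg hm hI
end
end

section
/- Let k be an infinite field and let d ≥ 1. For general polynomials F₁, F₂, F₃ of degree d in k[t], the rational functions F₁/F₃ and F₂/F₃ generate the full rational function field: k(F₁/F₃, F₂/F₃) = k(t). Equivalently, the rational map 𝔸¹ ⇢ 𝔸², t ↦ (F₁(t)/F₃(t), F₂(t)/F₃(t)), is birational onto its image: for a general point (a₁, a₂) of the image, the system F₁(t)/F₃(t) = a₁, F₂(t)/F₃(t) = a₂ has exactly one solution counted with multiplicity. -/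
noncomputable section

/-- The polynomial of degree `≤ d` in `k[t]` with coefficient vector `c`. -/
def polyOf {k : Type*} [Field k] (d : ℕ) (c : Fin (d + 1) → k) : Polynomial k :=
  ∑ l : Fin (d + 1), Polynomial.C (c l) * Polynomial.X ^ (l : ℕ)

open Polynomial in
/-- The quotient by `X` of `f(X) g(0) - f(0) g(X)`. -/
def secant {R : Type*} [CommRing R] (f g : R[X]) : R[X] :=
  divX (f * C (g.coeff 0) - C (f.coeff 0) * g)

open Polynomial in
theorem secant_mul_X {R : Type*} [CommRing R] (f g : R[X]) :
    secant f g * X = f * C (g.coeff 0) - C (f.coeff 0) * g := by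
  have h := divX_mul_X_add (f * C (g.coeff 0) - C (f.coeff 0) * g)
  simpa [secant] using h

open Polynomial in
theorem map_secant {R S : Type*} [CommRing R] [CommRing S] (φ : R →+* S) (f g : R[X]) :
    (secant f g).map φ = secant (f.map φ) (g.map φ) := by
  ext n
  simp [secant, coeff_divX]

open Polynomial in
theorem natDegree_polyOf_le {k : Type*} [Field k] (d : ℕ) (c : Fin (d + 1) → k) :
    (polyOf d c).natDegree ≤ d :=
  natDegree_sum_le_of_forall_le _ _ fun l _ =>
    (natDegree_C_mul_X_pow_le _ _).trans (Nat.lt_succ_iff.mp l.isLt)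

open Polynomial in
theorem coeff_zero_polyOf {k : Type*} [Field k] (d : ℕ) (c : Fin (d + 1) → k) :
    (polyOf d c).coeff 0 = c 0 := by
  rw [polyOf, finsetSum_coeff, Finset.sum_eq_single 0]
  · simp
  · intro l _ hl
    have : (l : ℕ) ≠ 0 := fun h => hl (Fin.ext h)
    simp [coeff_X_pow, this.symm]
  · simp

open Polynomial in
theorem polyOf_single {k : Type*} [Field k] (d : ℕ) (i : Fin (d + 1)) :
    polyOf d (Pi.single i (1 : k)) = X ^ (i : ℕ) := by
  rw [polyOf, Finset.sum_eq_single i]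
  · simp
  · intro l _ hl
    simp [hl]
  · simp

open Polynomial in
/-- The bivariate polynomial `(f(X) g(t) - f(t) g(X)) / (X - t)`, whose value at `t = 0` is
`secant f g`. -/
theorem exists_bivariate_secant {k : Type*} [Field k] {d : ℕ} {f g : k[X]}
    (hf : f.natDegree ≤ d) (hg : g.natDegree ≤ d) :
    ∃ H : k[X][X], (X - C X) * H = f.map C * C g - C f * g.map C ∧
      H.natDegree ≤ d - 1 ∧ H.map (evalRingHom 0) = secant f g := by
  have hroot : (f.map C * C g - C f * g.map C).IsRoot X := by
    simp [IsRoot, eval_map, eval₂_C_X]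
  obtain ⟨H, hH⟩ := dvd_iff_isRoot.mpr hroot
  refine ⟨H, hH.symm, ?_, ?_⟩
  · have hle : (f.map C * C g - C f * g.map C).natDegree ≤ d := by
      refine (natDegree_sub_le _ _).trans (max_le ?_ ?_)
      · exact (natDegree_mul_C_le _ _).trans (natDegree_map_le.trans hf)
      · exact (natDegree_C_mul_le _ _).trans (natDegree_map_le.trans hg)
    rcases eq_or_ne H 0 with rfl | h0
    · simp
    · rw [hH, natDegree_mul (X_sub_C_ne_zero _) h0, natDegree_X_sub_C] at hle
      omega
  · have hcomp : (evalRingHom (0 : k)).comp C = RingHom.id k := by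
      ext; simp
    have h := congrArg (Polynomial.map (evalRingHom (0 : k))) hH
    simp only [Polynomial.map_sub, Polynomial.map_mul, map_map, hcomp, map_id, map_C, map_X,
      coe_evalRingHom, eval_X, C_0, sub_zero, ← coeff_zero_eq_eval_zero] at h
    refine mul_right_cancel₀ X_ne_zero ?_
    rw [secant_mul_X, h, mul_comm]

open Polynomial in
/-- If `g₁, g₂` over `E` vanish at `x` and generate a nonzero multiple of `X - x`, then
`x` lies in `E`. -/
theorem mem_range_of_bezout {E K : Type*} [Field E] [Field K] [Algebra E K] {x r : K}
    {g₁ g₂ : E[X]} (h₁ : aeval x g₁ = 0) (h₂ : aeval x g₂ = 0) (hr : r ≠ 0) (p q : K[X])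
    (h : g₁.map (algebraMap E K) * p + g₂.map (algebraMap E K) * q = C r * (X - C x)) :
    x ∈ (algebraMap E K).range := by
  have hdvd : (minpoly E x).map (algebraMap E K) ∣ C r * (X - C x) := by
    rw [← h]
    exact dvd_add (((Polynomial.map_dvd_map' _).2 (minpoly.dvd E x h₁)).mul_right _)
      (((Polynomial.map_dvd_map' _).2 (minpoly.dvd E x h₂)).mul_right _)
  have hne : C r * (X - C x) ≠ 0 := mul_ne_zero (C_ne_zero.2 hr) (X_sub_C_ne_zero x)
  have hm : minpoly E x ≠ 0 := by
    intro h0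
    rw [h0, Polynomial.map_zero, zero_dvd_iff] at hdvd
    exact hne hdvd
  have hpos : 0 < (minpoly E x).natDegree := minpoly.natDegree_pos (minpoly.ne_zero_iff.1 hm)
  have hle := natDegree_le_of_dvd hdvd hne
  rw [natDegree_map, natDegree_C_mul hr, natDegree_X_sub_C] at hle
  exact minpoly.mem_range_of_degree_eq_one E x
    ((degree_eq_iff_natDegree_eq hm).2 (le_antisymm hle hpos))

open Polynomial in
theorem adjoin_div_eq_top {k : Type*} [Field k] {d : ℕ} (hd : 1 ≤ d) {f₁ f₂ g : k[X]}
    (hf₁ : f₁.natDegree ≤ d) (hf₂ : f₂.natDegree ≤ d) (hg : g.natDegree ≤ d) (hg0 : g ≠ 0)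
    (hres : resultant (secant f₁ g) (secant f₂ g) (d - 1) d ≠ 0) :
    IntermediateField.adjoin k
      ({algebraMap k[X] (RatFunc k) f₁ / algebraMap k[X] (RatFunc k) g,
        algebraMap k[X] (RatFunc k) f₂ / algebraMap k[X] (RatFunc k) g} :
          Set (RatFunc k)) = ⊤ := by
  set φ := algebraMap k[X] (RatFunc k) with hφ
  have hφinj : Function.Injective φ := RatFunc.algebraMap_injective k
  have hgφ : φ g ≠ 0 := (map_ne_zero_iff φ hφinj).2 hg0
  set E := IntermediateField.adjoin k ({φ f₁ / φ g, φ f₂ / φ g} : Set (RatFunc k))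
  obtain ⟨H₁, hH₁, hd₁, he₁⟩ := exists_bivariate_secant hf₁ hg
  obtain ⟨H₂, hH₂, hd₂, he₂⟩ := exists_bivariate_secant hf₂ hg
  obtain ⟨p, q, -, -, hpq⟩ := exists_mul_add_mul_eq_C_resultant (m := d - 1) (n := d)
    H₁ H₂ hd₁ (hd₂.trans (Nat.sub_le _ _)) (Or.inr (by omega))
  have hr : resultant H₁ H₂ (d - 1) d ≠ 0 := by
    intro h0
    apply hres
    rw [← he₁, ← he₂, resultant_map_map, h0, map_zero]
  have hφC : φ.comp C = algebraMap k (RatFunc k) := by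
    ext a; simp [hφ]
  have haeval (f : k[X]) : aeval (RatFunc.X : RatFunc k) f = φ f := by
    rw [← RatFunc.algebraMap_X, aeval_algebraMap_apply, aeval_X_left_apply]
  let G (f : k[X]) (a : E) : E[X] := f.map (algebraMap k E) - C a * g.map (algebraMap k E)
  have hGroot (f : k[X]) (a : E) (ha : (a : RatFunc k) = φ f / φ g) :
      aeval (RatFunc.X : RatFunc k) (G f a) = 0 := by
    simp only [G, map_sub, map_mul, aeval_C, aeval_map_algebraMap, haeval]
    rw [show algebraMap E (RatFunc k) a = φ f / φ g from ha, div_mul_cancel₀ _ hgφ, sub_self]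
  have hGmap (f : k[X]) (a : E) (ha : (a : RatFunc k) = φ f / φ g) :
      C (φ g) * (G f a).map (algebraMap E (RatFunc k)) =
        (f.map C * C g - C f * g.map C).map φ := by
    have ha' : C (φ g) * C (algebraMap E (RatFunc k) a) = C (φ f) := by
      rw [show algebraMap E (RatFunc k) a = φ f / φ g from ha, ← C_mul, mul_div_cancel₀ _ hgφ]
    simp only [G, Polynomial.map_sub, Polynomial.map_mul, map_map, map_C, hφC,
      ← IsScalarTower.algebraMap_eq]
    rw [← ha']
    ring
  let a₁ : E := ⟨φ f₁ / φ g, IntermediateField.subset_adjoin _ _ (by simp)⟩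
  let a₂ : E := ⟨φ f₂ / φ g, IntermediateField.subset_adjoin _ _ (by simp)⟩
  have hmem := mem_range_of_bezout (hGroot f₁ a₁ rfl) (hGroot f₂ a₂ rfl)
    ((map_ne_zero_iff φ hφinj).2 hr) (C (φ g) * p.map φ) (C (φ g) * q.map φ) (by
      have h := congrArg (Polynomial.map φ) (congrArg ((X - C X) * ·) hpq)
      simp only [mul_add, ← mul_assoc, hH₁, hH₂] at h
      rw [Polynomial.map_add, Polynomial.map_mul φ (q := p),
        Polynomial.map_mul φ (q := q),
        ← hGmap f₁ a₁ rfl, ← hGmap f₂ a₂ rfl] at h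
      simp only [Polynomial.map_mul, Polynomial.map_sub, map_X, map_C, hφ,
        RatFunc.algebraMap_X] at h ⊢
      linear_combination h)
  obtain ⟨x, hx⟩ := hmem
  rw [eq_top_iff, ← RatFunc.adjoin_X, IntermediateField.adjoin_simple_le_iff, ← hx]
  exact x.2

open Polynomial in
/-- The polynomial `∑ x_{i,l} X ^ l` whose coefficients are the variables `x_{i,l}`. -/
def genericPoly (k : Type*) [Field k] {ι : Type*} (d : ℕ) (i : ι) :
    (MvPolynomial (ι × Fin (d + 1)) k)[X] :=
  ∑ l : Fin (d + 1), C (MvPolynomial.X (i, l)) * X ^ (l : ℕ)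

open Polynomial in
theorem map_genericPoly {k : Type*} [Field k] {ι : Type*} (d : ℕ) (i : ι)
    (c : ι → Fin (d + 1) → k) :
    (genericPoly k d i).map (MvPolynomial.eval fun p => c p.1 p.2) = polyOf d (c i) := by
  simp [genericPoly, polyOf, Polynomial.map_sum]

open Polynomial in
theorem eval_resultant_genericPoly {k : Type*} [Field k] {ι : Type*} (d m n : ℕ) (i j l : ι)
    (c : ι → Fin (d + 1) → k) :
    MvPolynomial.eval (fun p => c p.1 p.2)
        (resultant (secant (genericPoly k d i) (genericPoly k d l))
          (secant (genericPoly k d j) (genericPoly k d l)) m n) =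
      resultant (secant (polyOf d (c i)) (polyOf d (c l)))
        (secant (polyOf d (c j)) (polyOf d (c l))) m n := by
  rw [← resultant_map_map, map_secant, map_secant, map_genericPoly, map_genericPoly,
    map_genericPoly]

open Polynomial in
theorem secant_X_pow_succ_one {R : Type*} [CommRing R] (n : ℕ) :
    secant (X ^ (n + 1) : R[X]) 1 = X ^ n := by
  ext m
  simp [secant, coeff_divX, coeff_X_pow, coeff_one]

/-- For an infinite field `k` and `d ≥ 1`, for general polynomials `F₁, F₂, F₃` of
degree `d` in `k[t]` (genericity encoded as the nonvanishing locus of a nonzero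
polynomial on the parameter space `k^{3(d+1)}` of coefficients), the rational
functions `F₁/F₃` and `F₂/F₃` generate the full rational function field:
`k(F₁/F₃, F₂/F₃) = k(t)`; equivalently, the rational map `𝔸¹ ⇢ 𝔸²`,
`t ↦ (F₁(t)/F₃(t), F₂(t)/F₃(t))`, is birational onto its image. -/
theorem general_rational_functions_generate (k : Type*) [Field k] [Infinite k]
    (d : ℕ) (hd : 1 ≤ d) :
    ∃ P : MvPolynomial (Fin 3 × Fin (d + 1)) k, P ≠ 0 ∧
      ∀ c : Fin 3 → Fin (d + 1) → k,
        MvPolynomial.eval (fun p => c p.1 p.2) P ≠ 0 →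
          IntermediateField.adjoin k
            ({algebraMap (Polynomial k) (RatFunc k) (polyOf d (c 0)) /
                algebraMap (Polynomial k) (RatFunc k) (polyOf d (c 2)),
              algebraMap (Polynomial k) (RatFunc k) (polyOf d (c 1)) /
                algebraMap (Polynomial k) (RatFunc k) (polyOf d (c 2))} :
              Set (RatFunc k)) = ⊤ := by
  let c₀ : Fin 3 → Fin (d + 1) → k :=
    ![Pi.single (Fin.last d) 1, Pi.single ⟨1, by omega⟩ 1, Pi.single 0 1]
  refine ⟨MvPolynomial.X (2, 0) *
    Polynomial.resultant (secant (genericPoly k d 0) (genericPoly k d 2))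
      (secant (genericPoly k d 1) (genericPoly k d 2)) (d - 1) d, ?_, fun c hc => ?_⟩
  · intro h
    have h' := congrArg (MvPolynomial.eval fun p => c₀ p.1 p.2) h
    rw [map_mul, eval_resultant_genericPoly] at h'
    obtain ⟨n, rfl⟩ := Nat.exists_eq_add_of_le' hd
    have h₁ := secant_X_pow_succ_one (R := k) 0
    rw [zero_add, pow_one, pow_zero] at h₁
    have hc₀ : polyOf (n + 1) (c₀ 0) = Polynomial.X ^ (n + 1) := polyOf_single _ _
    have hc₁ : polyOf (n + 1) (c₀ 1) = Polynomial.X := (polyOf_single _ _).trans (pow_one _)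
    have hc₂ : polyOf (n + 1) (c₀ 2) = 1 := (polyOf_single _ _).trans (pow_zero _)
    rw [hc₀, hc₁, hc₂, secant_X_pow_succ_one, h₁, Polynomial.resultant_one_right] at h'
    simp [c₀] at h'
  · rw [map_mul, eval_resultant_genericPoly, MvPolynomial.eval_X] at hc
    refine adjoin_div_eq_top hd (natDegree_polyOf_le _ _) (natDegree_polyOf_le _ _)
      (natDegree_polyOf_le _ _) ?_ (right_ne_zero_of_mul hc)
    intro h0
    apply left_ne_zero_of_mul hc
    rw [← coeff_zero_polyOf d (c 2), h0, Polynomial.coeff_zero]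
end
end
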